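/- Let U be a finite index subgroup of F₂ satisfying Property B. Then Stab(H₀) = ⋂_{n ≥ 1} Stab(Hₙ) and Γ(H₀) = ⋂_{n ≥ 1} Γ(Hₙ). -/

import Mathlib

/-- The free group on two generators. -/
abbrev F2 := FreeGroup (Fin 2)

/-- The generator `x` of `F₂`. -/
def xg : F2 := FreeGroup.of 0

/-- The generator `y` of `F₂`. -/
def yg : F2 := FreeGroup.of 1

/-- The exponent sum of the `i`-th generator, i.e. the `i`-th coordinate of the image in the
abelianization `ℤ²` of `F₂`. -/
def expSum (i : Fin 2) : F2 →* Multiplicative ℤ :=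
  FreeGroup.lift fun j => Multiplicative.ofAdd (if j = i then (1 : ℤ) else 0)

/-- The matrix in `GL₂(ℤ)` induced by an automorphism `γ` of `F₂` on the abelianization
`F₂^ab ≅ ℤ²` (with basis the images of `x` and `y`); i.e. `β̂(γ)`. -/
def autMat (γ : F2 ≃* F2) : Matrix (Fin 2) (Fin 2) ℤ :=
  Matrix.of fun i j => Multiplicative.toAdd (expSum i (γ (FreeGroup.of j)))

abbrev SL2Z := Matrix.SpecialLinearGroup (Fin 2) ℤ

/-- `Stab(V) = {γ ∈ Aut⁺(F₂) : γ(V) = V}`. -/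
def StabSet (V : Subgroup F2) : Set (F2 ≃* F2) :=
  { γ | (autMat γ).det = 1 ∧ Subgroup.map γ.toMonoidHom V = V }

/-- The Veech group `Γ(V) = β̂(Stab(V)) ⊆ SL₂(ℤ)` of a subgroup `V` of `F₂`. -/
def VeechGroup (V : Subgroup F2) : Set SL2Z :=
  { A | ∃ γ : F2 ≃* F2, γ ∈ StabSet V ∧ (A : Matrix (Fin 2) (Fin 2) ℤ) = autMat γ }

/-- A set of elements of `SL₂(ℤ)` is a congruence group if it contains the principal congruence
subgroup `Γ(n)` for some `n ≥ 1`. -/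
def IsCongruenceSet (S : Set SL2Z) : Prop :=
  ∃ n : ℕ, 1 ≤ n ∧ (CongruenceSubgroup.Gamma n : Set SL2Z) ⊆ S

/-- The subgroup of `Multiplicative ℤ` of elements divisible by `n`. -/
def divSub (n : ℤ) : Subgroup (Multiplicative ℤ) where
  carrier := {d | n ∣ Multiplicative.toAdd d}
  one_mem' := dvd_zero n
  mul_mem' := fun ha hb => dvd_add ha hb
  inv_mem' := fun ha => dvd_neg.mpr ha

/-- The subgroup `Hₙ = {u ∈ U : n ∣ α(u)}` of `F₂` (for `n = 0` this is `ker α = H₀`). -/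
def Hgrp {U : Subgroup F2} (α : U →* Multiplicative ℤ) (n : ℕ) : Subgroup F2 :=
  Subgroup.map U.subtype (Subgroup.comap α (divSub (n : ℤ)))

/-- The subgroup `U_L` of `F₂` corresponding to the origami `L(2,3)`. -/
def UL : Subgroup F2 :=
  Subgroup.closure {xg ^ 3, xg * yg * xg⁻¹, xg ^ 2 * yg * (xg ^ 2)⁻¹, yg * xg * yg⁻¹, yg ^ 2}

/-- The subgroup `U_D` of `F₂` corresponding to the origami `D`. -/
def UD : Subgroup F2 :=
  Subgroup.closure {xg ^ 3, xg * yg * (xg ^ 2)⁻¹, xg ^ 2 * yg * xg⁻¹, yg * xg * yg⁻¹,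
    yg ^ 2 * xg * (yg ^ 2)⁻¹, yg ^ 3}

namespace FreeGroup

variable {α : Type*} [DecidableEq α]

/-- The length of the longest common prefix of two lists. -/
def commonPrefixLength {β : Type*} [DecidableEq β] : List β → List β → ℕ
  | a :: l, b :: m => if a = b then commonPrefixLength l m + 1 else 0
  | _, _ => 0

lemma min_commonPrefixLength_le {β : Type*} [DecidableEq β] (l m n : List β) :
    min (commonPrefixLength l m) (commonPrefixLength m n) ≤ commonPrefixLength l n := by
  induction l generalizing m n with
  | nil => simp [commonPrefixLength]
  | cons a l ih =>
    rcases m with _ | ⟨b, m⟩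
    · simp [commonPrefixLength]
    rcases n with _ | ⟨c, n⟩
    · simp [commonPrefixLength]
    have := ih m n
    simp only [commonPrefixLength]
    grind

lemma norm_mk_of_isReduced {L : List (α × Bool)} (h : IsReduced L) :
    norm (mk L) = L.length := by
  rw [norm, toWord_mk, h.reduce_eq]

lemma IsReduced.invRev {L : List (α × Bool)} (h : IsReduced L) :
    IsReduced (FreeGroup.invRev L) := by
  rw [isReduced_iff_reduce_eq, reduce_invRev, h.reduce_eq]

lemma norm_mk_invRev_append (L M : List (α × Bool)) (hL : IsReduced L) (hM : IsReduced M) :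
    norm (mk (invRev L ++ M)) + 2 * commonPrefixLength L M = L.length + M.length := by
  induction L generalizing M with
  | nil => simp [commonPrefixLength, norm_mk_of_isReduced hM]
  | cons a L ih =>
    rcases M with _ | ⟨b, M⟩
    · simp only [commonPrefixLength, List.append_nil, norm_mk_of_isReduced hL.invRev]
      simp
    by_cases hab : a = b
    · subst hab
      have hL' : IsReduced L := hL.infix (List.suffix_cons a L).isInfix
      have hM' : IsReduced M := hM.infix (List.suffix_cons a M).isInfix
      have key : mk (invRev (a :: L) ++ a :: M) = mk (invRev L ++ M) := by
        have h1 : mk (a :: L) = mk [a] * mk L := by simp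
        have h2 : mk (a :: M) = mk [a] * mk M := by simp
        rw [← mul_mk, ← mul_mk, ← inv_mk, ← inv_mk, h1, h2]
        group
      have := ih M hL' hM'
      rw [key]
      simp only [commonPrefixLength, if_true, List.length_cons]
      omega
    · have hred : IsReduced (invRev (a :: L) ++ b :: M) := by
        refine List.isChain_append.2 ⟨hL.invRev, hM, ?_⟩
        intro x hx y hy hxy
        simp only [FreeGroup.invRev, List.map_cons, List.reverse_cons, List.getLast?_append,
          List.getLast?_singleton, Option.some_or, Option.mem_def, Option.some.injEq,
          List.head?_cons] at hx hy
        subst hx hy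
        rcases a with ⟨a, ε⟩
        rcases b with ⟨b, δ⟩
        simp only at hxy
        subst hxy
        cases ε <;> cases δ <;> simp_all
      rw [norm_mk_of_isReduced hred]
      simp [commonPrefixLength, hab]

/-- The Gromov product of two elements of a free group, i.e. the length of the longest common
prefix of the corresponding reduced words. -/
def gromov (g h : FreeGroup α) : ℕ :=
  commonPrefixLength g.toWord h.toWord

lemma norm_inv_mul (g h : FreeGroup α) :
    norm (g⁻¹ * h) + 2 * gromov g h = norm g + norm h := by
  have := norm_mk_invRev_append g.toWord h.toWord isReduced_toWord isReduced_toWord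
  rwa [← mul_mk, ← inv_mk, mk_toWord, mk_toWord] at this

lemma norm_mul_gromov (g h : FreeGroup α) :
    norm (g * h) + 2 * gromov g⁻¹ h = norm g + norm h := by
  simpa using norm_inv_mul g⁻¹ h

lemma min_gromov_le (g h k : FreeGroup α) : min (gromov g h) (gromov h k) ≤ gromov g k :=
  min_commonPrefixLength_le _ _ _

lemma gromov_comm (g h : FreeGroup α) : gromov g h = gromov h g := by
  have h1 := norm_inv_mul g h
  have h2 := norm_inv_mul h g
  have h3 : norm (g⁻¹ * h) = norm (h⁻¹ * g) := by
    rw [← norm_inv_eq]; simp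
  omega

lemma norm_lt_norm_mul_self {u : FreeGroup α} (hu : u ≠ 1) : norm u < norm (u * u) := by
  have h1 := reduceCyclically.reduce_flatten_replicate_succ (isReduced_toWord (x := u)) 0
  have h2 := reduceCyclically.reduce_flatten_replicate_succ (isReduced_toWord (x := u)) 1
  simp only [List.replicate_succ, List.replicate_zero, List.flatten_cons, List.flatten_nil,
    List.append_nil, ← toWord_mul, reduce_toWord, zero_add] at h1 h2
  have h3 : (reduceCyclically u.toWord).length ≠ 0 := by
    intro h0
    rw [List.length_eq_zero_iff] at h0
    rw [h0] at h1
    apply hu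
    rw [← mk_toWord (x := u), h1, List.append_nil, ← mul_mk, ← inv_mk, mul_inv_cancel]
  have h4 := congrArg List.length h1
  have h5 := congrArg List.length h2
  simp only [List.length_append, invRev_length] at h4 h5
  simp only [norm]
  omega

lemma exists_eq_mul_norm (g : FreeGroup α) {n : ℕ} (hn : n ≤ norm g) :
    ∃ p q, g = p * q ∧ norm p = n ∧ norm q + n = norm g := by
  refine ⟨mk (g.toWord.take n), mk (g.toWord.drop n), ?_, ?_, ?_⟩
  · rw [mul_mk, List.take_append_drop, mk_toWord]
  · rw [norm_mk_of_isReduced (isReduced_toWord.infix (List.take_prefix _ _).isInfix)]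
    simpa [norm] using hn
  · rw [norm_mk_of_isReduced (isReduced_toWord.infix (List.drop_suffix _ _).isInfix)]
    simp only [norm, List.length_drop] at hn ⊢
    omega

/-- If there is only little cancellation in the products of the images of the letters, then a
homomorphism between free groups does not decrease the norm. -/
lemma norm_le_norm_map {β : Type*} [DecidableEq β] (f : FreeGroup α →* FreeGroup β)
    (h1 : ∀ u : α × Bool, f (mk [u]) ≠ 1)
    (h : ∀ u v w : α × Bool, mk [u] * mk [v] ≠ 1 → mk [v] * mk [w] ≠ 1 →
      gromov (f (mk [u]))⁻¹ (f (mk [v])) + gromov (f (mk [v]))⁻¹ (f (mk [w]))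
        < norm (f (mk [v]))) (g : FreeGroup α) :
    norm g ≤ norm (f g) := by
  have key : ∀ (L : List (α × Bool)) (u : α × Bool), IsReduced (u :: L) →
      (L.length + 1 ≤ norm (f (mk (u :: L)))) ∧
      ∀ v : α × Bool, mk [v] * mk [u] ≠ 1 →
      gromov (f (mk [v]))⁻¹ (f (mk (u :: L))) = gromov (f (mk [v]))⁻¹ (f (mk [u])) ∧
      L.length + 1 + gromov (f (mk [v]))⁻¹ (f (mk [u])) ≤ norm (f (mk (u :: L))) := by
    intro L
    induction L with
    | nil =>
      intro u _
      have hu := h1 u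
      rw [Ne, ← norm_eq_zero] at hu
      refine ⟨by rw [List.length_nil]; omega, fun v hv => ⟨rfl, ?_⟩⟩
      have huu : mk [u] * mk [u] ≠ 1 := by
        intro h0
        rcases u with ⟨a, _ | _⟩ <;> simpa using congrArg toWord h0
      have := h v u u hv huu
      simp only [List.length_nil]
      omega
    | cons w L ih =>
      intro u hred
      have hL : IsReduced (w :: L) := hred.infix (List.suffix_cons u _).isInfix
      have huw : mk [u] * mk [w] ≠ 1 := by
        have h2 : IsReduced [u, w] := hred.infix ⟨[], L, rfl⟩
        intro h0
        have := congrArg norm h0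
        rw [mul_mk, List.singleton_append, norm_mk_of_isReduced h2] at this
        simp at this
      obtain ⟨-, ih⟩ := ih w hL
      obtain ⟨ih1, ih2⟩ := ih u huw
      have e : f (mk (u :: w :: L)) = f (mk [u]) * f (mk (w :: L)) := by
        rw [← _root_.map_mul, mul_mk, List.singleton_append]
      have n1 := norm_mul_gromov (f (mk [u])) (f (mk (w :: L)))
      have n2 := norm_inv_mul (f (mk [u])) (f (mk (u :: w :: L)))
      rw [e, inv_mul_cancel_left, ← e] at n2
      rw [← e, ih1] at n1
      have hu := h1 u
      rw [Ne, ← norm_eq_zero] at hu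
      simp only [List.length_cons]
      have huu : mk [u] * mk [u] ≠ 1 := by
        intro h0
        rcases u with ⟨a, _ | _⟩ <;> simpa using congrArg toWord h0
      have n3 := h u u w huu huw
      refine ⟨by omega, fun v hv => ?_⟩
      have n4 := h v u w hv huw
      have m1 := min_gromov_le (f (mk [u])) (f (mk (u :: w :: L))) (f (mk [v]))⁻¹
      have m2 := min_gromov_le (f (mk (u :: w :: L))) (f (mk [u])) (f (mk [v]))⁻¹
      rw [gromov_comm _ (f (mk [v]))⁻¹, gromov_comm _ (f (mk [v]))⁻¹] at m1 m2
      rw [gromov_comm _ (f (mk [u]))] at m2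
      omega
  rcases hg : g.toWord with _ | ⟨u, L⟩
  · simp [norm, hg]
  · have := (key L u (hg ▸ isReduced_toWord)).1
    rw [← hg, mk_toWord] at this
    simpa [norm, hg] using this

/-- The balanced cancellation case of Nielsen reduction: if `u` and `v` cancel exactly half of `v`
in both products `u * v` and `v * u`, then a suitable conjugation decreases the total norm. -/
lemma exists_conj_norm_lt {u v : FreeGroup α} (hv : v ≠ 1)
    (h1 : 2 * gromov u⁻¹ v = norm v) (h2 : 2 * gromov v⁻¹ u = norm v) (h : norm v ≤ norm u) :
    ∃ p, norm (p⁻¹ * v * p) + norm (p⁻¹ * (v * u) * p) < norm v + norm u := by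
  have hv0 : norm v ≠ 0 := norm_eq_zero.not.2 hv
  obtain ⟨p, s, rfl, hp, hs⟩ := exists_eq_mul_norm v (n := gromov u⁻¹ v) (by omega)
  refine ⟨p, ?_⟩
  have e1 : p⁻¹ * (p * s) * p = s * p := by group
  have e2 : p⁻¹ * (p * s * u) * p = ((s * u)⁻¹)⁻¹ * p := by group
  have a1 := norm_inv_mul p (p * s)
  have a2 := norm_inv_mul p u⁻¹
  have a3 := norm_inv_mul s⁻¹ (p * s)⁻¹
  have a4 := norm_inv_mul s⁻¹ u
  have a5 := norm_inv_mul (s * u)⁻¹ u⁻¹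
  have a6 := norm_inv_mul (s * u)⁻¹ p
  have a7 := norm_mul_le s p
  have a8 := norm_mul_le s⁻¹ (s * u)
  have e3 : s⁻¹⁻¹ * (p * s)⁻¹ = p⁻¹ := by group
  have e4 : (s * u)⁻¹⁻¹ * u⁻¹ = s := by group
  rw [inv_mul_cancel_left] at a1 a8
  rw [e3] at a3
  rw [e4] at a5
  rw [inv_inv] at a4
  simp only [norm_inv_eq] at a1 a2 a3 a4 a5 a6 a7 a8
  have m1 := min_gromov_le p (p * s) u⁻¹
  have m2 := min_gromov_le s⁻¹ (p * s)⁻¹ u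
  have m3 := min_gromov_le (s * u)⁻¹ u⁻¹ p
  rw [gromov_comm _ u⁻¹] at m1
  rw [gromov_comm u⁻¹ p] at m3
  rw [e1, e2]
  omega

end FreeGroup

/-- A group-theoretic presentation argument: if `s` and `l` satisfy the defining relations of
`SL₂(ℤ)` and are mapped to the standard generators, then `M` is injective on the subgroup that
they generate. -/
theorem eq_one_of_mem_closure_of_map_eq_one {Q : Type*} [Group Q]
    (M : Q →* Matrix (Fin 2) (Fin 2) ℤ) {s l : Q} (hMs : M s = !![0, -1; 1, 0])
    (hMl : M l = !![1, 0; 1, 1]) (hs : s ^ 4 = 1) (hsl : Commute (s ^ 2) l)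
    (hbraid : l * s⁻¹ * l * s * l = s) {q : Q} (hq : q ∈ Subgroup.closure {s, l})
    (hMq : M q = 1) : q = 1 := by
  set r : Q := s⁻¹ * l⁻¹ * s with hr
  let word : List Bool → Q := fun w => (w.map fun b => if b then l else r).prod
  have hlsl : l * s * l = s ^ 2 * r := by
    have h1 : s * l * s⁻¹ = s⁻¹ * l * s := by
      have := hsl.eq
      calc s * l * s⁻¹ = s⁻¹ * (s ^ 2 * l) * s⁻¹ := by group
        _ = s⁻¹ * (l * s ^ 2) * s⁻¹ := by rw [this]
        _ = s⁻¹ * l * s := by group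
    calc l * s * l = l * (s * l * s⁻¹) * s := by group
      _ = (l * s⁻¹ * l * s * l) * l⁻¹ * s := by rw [h1]; group
      _ = s ^ 2 * r := by rw [hbraid, hr]; group
  have hmul_s : ∀ (n : ℤ) (q : Q), (∃ (i j : ℤ) (w : List Bool), q = s ^ i * word w * s ^ j) →
      ∃ (i j : ℤ) (w : List Bool), s ^ n * q = s ^ i * word w * s ^ j := by
    rintro n q ⟨i, j, w, rfl⟩
    exact ⟨n + i, j, w, by rw [zpow_add]; group⟩
  have hmul_l : ∀ q : Q, (∃ (i j : ℤ) (w : List Bool), q = s ^ i * word w * s ^ j) →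
      ∃ (i j : ℤ) (w : List Bool), l * q = s ^ i * word w * s ^ j := by
    rintro q ⟨i, j, w, rfl⟩
    obtain ⟨t, rfl | rfl⟩ := Int.even_or_odd' i
    · refine ⟨2 * t, j, true :: w, ?_⟩
      have : Commute (s ^ (2 * t)) l := by
        rw [zpow_mul]
        exact_mod_cast hsl.zpow_left t
      simp only [word, List.map_cons, List.prod_cons, if_true]
      simp only [← mul_assoc]
      rw [this.eq]
    · have : Commute (s ^ (2 * t)) l := by
        rw [zpow_mul]
        exact_mod_cast hsl.zpow_left t
      rw [zpow_add, zpow_one]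
      simp only [← mul_assoc]
      rw [← this.eq]
      rcases w with _ | ⟨_ | _, w⟩
      · exact ⟨2 * t, 1 + j, [true], by simp [word, zpow_add, mul_assoc]⟩
      · refine ⟨2 * t + 1, j, w, ?_⟩
        simp only [word, List.map_cons, List.prod_cons, hr]
        rw [zpow_add]
        simp [mul_assoc]
      · refine ⟨2 * t + 2, j, false :: w, ?_⟩
        have h2 : s ^ (2 * t) * l * s * word (true :: w) * s ^ j
            = s ^ (2 * t) * (l * s * l) * word w * s ^ j := by
          simp [word, mul_assoc]
        rw [h2, hlsl, zpow_add]
        simp only [word, List.map_cons, List.prod_cons, mul_assoc]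
        simp
  have hform : ∃ (i j : ℤ) (w : List Bool), q = s ^ i * word w * s ^ j := by
    clear hMq
    induction hq using Subgroup.closure_induction_left with
    | one => exact ⟨0, 0, [], by simp [word]⟩
    | mul_left x hx y hy ih =>
      rcases hx with rfl | rfl
      · simpa using hmul_s 1 y ih
      · exact hmul_l y ih
    | inv_mul_cancel x hx y hy ih =>
      rcases hx with rfl | rfl
      · simpa using hmul_s (-1) y ih
      · have h1 : x⁻¹ * y = s ^ (-1 : ℤ) * (x * (s ^ (1 : ℤ) * (x * (s ^ (-1 : ℤ) * y)))) := by
          have h2 : x⁻¹ = s⁻¹ * x * s * x * s⁻¹ :=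
            inv_eq_of_mul_eq_one_right (by
              calc x * (s⁻¹ * x * s * x * s⁻¹) = (x * s⁻¹ * x * s * x) * s⁻¹ := by group
                _ = 1 := by rw [hbraid, mul_inv_cancel])
          rw [h2]
          group
        rw [h1]
        exact hmul_s _ _ (hmul_l _ (hmul_s _ _ (hmul_l _ (hmul_s _ _ ih))))
  obtain ⟨i, j, w, rfl⟩ := hform
  have hMs' : M s⁻¹ = !![0, 1; -1, 0] := by
    have h1 : s⁻¹ = s ^ 3 := inv_eq_of_mul_eq_one_right (by rw [← pow_succ', hs])
    rw [h1, map_pow, hMs]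
    decide
  have hMl' : M l⁻¹ = !![1, 0; -1, 1] := by
    have h1 : M l⁻¹ * M l = 1 := by rw [← map_mul, inv_mul_cancel, map_one]
    have h2 : M l * !![1, 0; -1, 1] = 1 := by rw [hMl]; decide
    exact left_inv_eq_right_inv h1 h2
  have hMr : M r = !![1, 1; 0, 1] := by
    rw [hr, map_mul, map_mul, hMs', hMl', hMs]
    decide
  have hword : ∀ w, 1 ≤ M (word w) 0 0 ∧ 0 ≤ M (word w) 0 1 ∧ 0 ≤ M (word w) 1 0 ∧
      1 ≤ M (word w) 1 1 ∧ (w = [] ∨ 1 ≤ M (word w) 0 1 + M (word w) 1 0) := by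
    intro w
    induction w with
    | nil => simp [word]
    | cons b w ih =>
      have h1 : M (word (b :: w)) = (if b then M l else M r) * M (word w) := by
        cases b <;> simp [word]
      rw [h1]
      cases b <;> simp [hMl, hMr, Matrix.mul_apply, Fin.sum_univ_two] <;> omega
  have hMw : M (word w * s ^ (i + j)) = 1 := by
    have h1 : word w * s ^ (i + j) = (s ^ i)⁻¹ * (s ^ i * word w * s ^ j) * s ^ i := by
      rw [add_comm, zpow_add]; group
    rw [h1, map_mul, map_mul, hMq, mul_one, ← map_mul, inv_mul_cancel, map_one]
  have hmod : s ^ (i + j) = s ^ ((i + j) % 4) := by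
    conv_lhs => rw [← Int.emod_add_mul_ediv (i + j) 4, zpow_add, zpow_mul]
    have : s ^ (4 : ℤ) = 1 := by exact_mod_cast hs
    rw [this, one_zpow, mul_one]
  have hij : s ^ i * word w * s ^ j = s ^ i * (word w * s ^ (i + j)) * (s ^ i)⁻¹ := by
    rw [add_comm i j, zpow_add]; group
  rw [hij]
  rw [hmod] at hMw ⊢
  have hw := hword w
  have h0 : 0 ≤ (i + j) % 4 := Int.emod_nonneg _ (by norm_num)
  have h4 : (i + j) % 4 < 4 := Int.emod_lt_of_pos _ (by norm_num)
  generalize (i + j) % 4 = n at *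
  obtain ⟨n, rfl⟩ := Int.eq_ofNat_of_zero_le h0
  rw [zpow_natCast, map_mul, map_pow, hMs] at hMw
  have e00 := congrFun (congrFun hMw 0) 0
  have e01 := congrFun (congrFun hMw 0) 1
  have e10 := congrFun (congrFun hMw 1) 0
  have e11 := congrFun (congrFun hMw 1) 1
  have hn : n < 4 := by omega
  interval_cases n
  · simp only [pow_zero, mul_one, Matrix.one_apply] at e01 e10
    obtain rfl : w = [] := by
      rcases hw.2.2.2.2 with h | h
      · exact h
      · simp at e01 e10
        omega
    simp [word]
  all_goals
    simp [pow_succ, Matrix.mul_apply, Fin.sum_univ_two] at e00 e01 e10 e11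
    omega

lemma mem_closure_pair_or_mul_mem {Q : Type*} [Group Q] {s l e : Q} (hee : e * e = 1)
    (hes : e * s * e = s⁻¹) (hel : e * l * e = l⁻¹) {q : Q}
    (hq : q ∈ Subgroup.closure {s, l, e}) :
    q ∈ Subgroup.closure {s, l} ∨ e * q ∈ Subgroup.closure {s, l} := by
  have hs : s ∈ Subgroup.closure {s, l} := Subgroup.subset_closure (by simp)
  have hl : l ∈ Subgroup.closure {s, l} := Subgroup.subset_closure (by simp)
  have hee' : e⁻¹ = e := inv_eq_of_mul_eq_one_left hee
  have key : ∀ x y : Q, x ∈ Subgroup.closure {s, l} → e * x * e ∈ Subgroup.closure {s, l} →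
      (y ∈ Subgroup.closure {s, l} ∨ e * y ∈ Subgroup.closure {s, l}) →
      (x * y ∈ Subgroup.closure {s, l} ∨ e * (x * y) ∈ Subgroup.closure {s, l}) := by
    rintro x y hx hex (hy | hy)
    · exact Or.inl (mul_mem hx hy)
    · refine Or.inr ?_
      have : e * (x * y) = e * x * e * (e * y) := by
        rw [mul_assoc (e * x) e, ← mul_assoc e e, hee, one_mul, mul_assoc]
      rw [this]
      exact mul_mem hex hy
  have keye : ∀ y : Q, (y ∈ Subgroup.closure {s, l} ∨ e * y ∈ Subgroup.closure {s, l}) →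
      (e * y ∈ Subgroup.closure {s, l} ∨ e * (e * y) ∈ Subgroup.closure {s, l}) := by
    rintro y (hy | hy)
    · exact Or.inr (by rwa [← mul_assoc, hee, one_mul])
    · exact Or.inl hy
  have hinv : ∀ x : Q, e * x⁻¹ * e = (e * x * e)⁻¹ := fun x => by
    simp [hee', mul_assoc]
  induction hq using Subgroup.closure_induction_left with
  | one => exact Or.inl (one_mem _)
  | mul_left x hx y hy ih =>
    rcases hx with rfl | rfl | rfl
    · exact key _ _ hs (hes ▸ inv_mem hs) ih
    · exact key _ _ hl (hel ▸ inv_mem hl) ih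
    · exact keye _ ih
  | inv_mul_cancel x hx y hy ih =>
    rcases hx with rfl | rfl | rfl
    · exact key _ _ (inv_mem hs) (by rwa [hinv, hes, inv_inv]) ih
    · exact key _ _ (inv_mem hl) (by rwa [hinv, hel, inv_inv]) ih
    · rw [hee']
      exact keye _ ih

theorem eq_one_of_mem_closure_triple_of_map_eq_one {Q : Type*} [Group Q]
    (M : Q →* Matrix (Fin 2) (Fin 2) ℤ) {s l e : Q} (hMs : M s = !![0, -1; 1, 0])
    (hMl : M l = !![1, 0; 1, 1]) (hMe : M e = !![-1, 0; 0, 1])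
    (hs : s ^ 4 = 1) (hsl : Commute (s ^ 2) l)
    (hbraid : l * s⁻¹ * l * s * l = s) (hee : e * e = 1) (hes : e * s * e = s⁻¹)
    (hel : e * l * e = l⁻¹) {q : Q} (hq : q ∈ Subgroup.closure {s, l, e})
    (hMq : M q = 1) : q = 1 := by
  refine eq_one_of_mem_closure_of_map_eq_one M hMs hMl hs hsl hbraid ?_ hMq
  refine (mem_closure_pair_or_mul_mem hee hes hel hq).resolve_right fun h => ?_
  have hle : Subgroup.closure {s, l} ≤ (Matrix.detMonoidHom.comp M).ker := by
    rw [Subgroup.closure_le]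
    rintro x (rfl | rfl) <;>
      simp [MonoidHom.mem_ker, hMs, hMl, Matrix.det_fin_two_of]
  have := MonoidHom.mem_ker.1 (hle h)
  simp [hMe, hMq, Matrix.det_fin_two_of] at this

/-- The automorphism `x ↦ y`, `y ↦ x⁻¹` of `F₂`. -/
def rotAut : MulAut F2 :=
  MonoidHom.toMulEquiv (FreeGroup.lift ![yg, xg⁻¹]) (FreeGroup.lift ![yg⁻¹, xg])
    (by ext i; fin_cases i <;> simp [xg, yg]) (by ext i; fin_cases i <;> simp [xg, yg])

/-- The automorphism `x ↦ x * y`, `y ↦ y` of `F₂`. -/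
def shearAut : MulAut F2 :=
  MonoidHom.toMulEquiv (FreeGroup.lift ![xg * yg, yg]) (FreeGroup.lift ![xg * yg⁻¹, yg])
    (by ext i; fin_cases i <;> simp [xg, yg]) (by ext i; fin_cases i <;> simp [xg, yg])

/-- The automorphism `x ↦ x⁻¹`, `y ↦ y` of `F₂`. -/
def reflAut : MulAut F2 :=
  MonoidHom.toMulEquiv (FreeGroup.lift ![xg⁻¹, yg]) (FreeGroup.lift ![xg⁻¹, yg])
    (by ext i; fin_cases i <;> simp [xg, yg]) (by ext i; fin_cases i <;> simp [xg, yg])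

@[simp] lemma rotAut_x : rotAut xg = yg := by simp [rotAut, xg]
@[simp] lemma rotAut_y : rotAut yg = xg⁻¹ := by simp [rotAut, yg]
@[simp] lemma rotAut_symm_x : (MulEquiv.symm rotAut) xg = yg⁻¹ := by
  rw [MulEquiv.symm_apply_eq]; simp
@[simp] lemma rotAut_symm_y : (MulEquiv.symm rotAut) yg = xg := by
  rw [MulEquiv.symm_apply_eq]; simp
@[simp] lemma shearAut_x : shearAut xg = xg * yg := by simp [shearAut, xg]
@[simp] lemma shearAut_y : shearAut yg = yg := by simp [shearAut, yg]
@[simp] lemma shearAut_symm_x : (MulEquiv.symm shearAut) xg = xg * yg⁻¹ := by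
  rw [MulEquiv.symm_apply_eq]; simp
@[simp] lemma shearAut_symm_y : (MulEquiv.symm shearAut) yg = yg := by
  rw [MulEquiv.symm_apply_eq]; simp
@[simp] lemma reflAut_x : reflAut xg = xg⁻¹ := by simp [reflAut, xg]
@[simp] lemma reflAut_y : reflAut yg = yg := by simp [reflAut, yg]

lemma mulAut_F2_ext {γ δ : MulAut F2} (hx : γ xg = δ xg) (hy : γ yg = δ yg) : γ = δ := by
  have : γ.toMonoidHom = δ.toMonoidHom := by
    ext i
    fin_cases i
    · exact hx
    · exact hy
  exact MulEquiv.toMonoidHom_injective this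

/-- The subgroup of `Aut(F₂)` generated by the inner automorphisms and the elementary ones. -/
def elemAut : Subgroup (MulAut F2) :=
  (MulAut.conj : F2 →* MulAut F2).range ⊔ Subgroup.closure {rotAut, shearAut, reflAut}

lemma conj_mem_elemAut (w : F2) : MulAut.conj w ∈ elemAut :=
  (le_sup_left : _ ≤ elemAut) ⟨w, rfl⟩
lemma rotAut_mem : rotAut ∈ elemAut :=
  (le_sup_right : _ ≤ elemAut) (Subgroup.subset_closure (by simp))
lemma shearAut_mem : shearAut ∈ elemAut :=
  (le_sup_right : _ ≤ elemAut) (Subgroup.subset_closure (by simp))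
lemma reflAut_mem : reflAut ∈ elemAut :=
  (le_sup_right : _ ≤ elemAut) (Subgroup.subset_closure (by simp))

/-- The inverse of a letter. -/
def invLetter (u : Fin 2 × Bool) : Fin 2 × Bool := (u.1, !u.2)

lemma mk_invLetter (u : Fin 2 × Bool) :
    FreeGroup.mk [invLetter u] = (FreeGroup.mk [u])⁻¹ := by
  simp [FreeGroup.inv_mk, FreeGroup.invRev, invLetter]

/-- Any two letters belonging to different generators are the image of `(x, y)` under an
automorphism generated by the elementary ones. -/
lemma exists_mem_elemAut_map_eq (u v : Fin 2 × Bool) (huv : u.1 ≠ v.1) :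
    ∃ σ ∈ elemAut, σ xg = FreeGroup.mk [u] ∧ σ yg = FreeGroup.mk [v] := by
  have hR := rotAut_mem
  have hE := reflAut_mem
  have hx : FreeGroup.mk [((0 : Fin 2), true)] = xg := rfl
  have hy : FreeGroup.mk [((1 : Fin 2), true)] = yg := rfl
  have hx' : FreeGroup.mk [((0 : Fin 2), false)] = xg⁻¹ := rfl
  have hy' : FreeGroup.mk [((1 : Fin 2), false)] = yg⁻¹ := rfl
  rcases u with ⟨i, _ | _⟩ <;> rcases v with ⟨j, _ | _⟩ <;> fin_cases i <;> fin_cases j <;>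
    first
    | exact absurd rfl huv
    | simp only [Fin.zero_eta, Fin.mk_one, hx, hy, hx', hy']
  · exact ⟨rotAut * rotAut, mul_mem hR hR, by simp, by simp⟩
  · exact ⟨rotAut * reflAut, mul_mem hR hE, by simp, by simp⟩
  · exact ⟨reflAut, hE, by simp, by simp⟩
  · exact ⟨rotAut⁻¹, inv_mem hR, by simp, by simp⟩
  · exact ⟨rotAut * rotAut * reflAut, mul_mem (mul_mem hR hR) hE, by simp, by simp⟩
  · exact ⟨rotAut, hR, by simp, by simp⟩
  · exact ⟨1, one_mem _, by simp, by simp⟩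
  · exact ⟨rotAut⁻¹ * reflAut, mul_mem (inv_mem hR) hE, by simp, by simp⟩

/-- The total norm of the images of the two generators. -/
def autNorm (γ : MulAut F2) : ℕ := (γ xg).norm + (γ yg).norm

lemma norm_add_norm_eq_autNorm (γ : MulAut F2) (u v : Fin 2 × Bool) (huv : u.1 ≠ v.1) :
    (γ (FreeGroup.mk [u])).norm + (γ (FreeGroup.mk [v])).norm = autNorm γ := by
  have h : ∀ u : Fin 2 × Bool,
      (γ (FreeGroup.mk [u])).norm = (γ (FreeGroup.of u.1)).norm := by
    rintro ⟨i, _ | _⟩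
    · have : FreeGroup.mk [(i, false)] = (FreeGroup.of i)⁻¹ := rfl
      rw [this, map_inv, FreeGroup.norm_inv_eq]
    · rfl
  rw [h, h, autNorm]
  rcases u with ⟨i, _⟩
  rcases v with ⟨j, _⟩
  fin_cases i <;> fin_cases j <;> first | exact absurd rfl huv | rfl | exact add_comm _ _

lemma mk_singleton_ne_one {α : Type*} (u : α × Bool) : FreeGroup.mk [u] ≠ 1 := by
  classical
  rcases u with ⟨a, _ | _⟩ <;> intro h0 <;> simpa using congrArg FreeGroup.toWord h0

lemma eq_or_eq_invLetter {u v : Fin 2 × Bool} (h : u.1 = v.1) : v = u ∨ v = invLetter u := by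
  rcases u with ⟨i, _ | _⟩ <;> rcases v with ⟨j, _ | _⟩ <;> simp_all [invLetter]

lemma mem_elemAut_of_norm_mul_lt {γ : MulAut F2}
    (hmin : ∀ δ : MulAut F2, autNorm δ < autNorm γ → δ ∈ elemAut) {u v : Fin 2 × Bool}
    (huv : u.1 ≠ v.1)
    (h : (γ (FreeGroup.mk [u]) * γ (FreeGroup.mk [v])).norm < (γ (FreeGroup.mk [u])).norm) :
    γ ∈ elemAut := by
  obtain ⟨σ, hσ, hx, hy⟩ := exists_mem_elemAut_map_eq u v huv
  have hN := norm_add_norm_eq_autNorm γ u v huv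
  have hm : γ * σ * shearAut ∈ elemAut := by
    apply hmin
    have : autNorm (γ * σ * shearAut) =
        (γ (FreeGroup.mk [u]) * γ (FreeGroup.mk [v])).norm + (γ (FreeGroup.mk [v])).norm := by
      simp only [autNorm, MulAut.mul_apply, shearAut_x, shearAut_y, map_mul, hx, hy]
    omega
  rwa [Subgroup.mul_mem_cancel_right _ shearAut_mem, Subgroup.mul_mem_cancel_right _ hσ] at hm

lemma mem_elemAut_of_norm_conj_lt {γ : MulAut F2}
    (hmin : ∀ δ : MulAut F2, autNorm δ < autNorm γ → δ ∈ elemAut) {u v : Fin 2 × Bool}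
    (huv : u.1 ≠ v.1) (p : F2)
    (h : (p⁻¹ * γ (FreeGroup.mk [v]) * p).norm +
      (p⁻¹ * (γ (FreeGroup.mk [v]) * γ (FreeGroup.mk [u])) * p).norm <
      (γ (FreeGroup.mk [v])).norm + (γ (FreeGroup.mk [u])).norm) :
    γ ∈ elemAut := by
  obtain ⟨σ, hσ, hx, hy⟩ := exists_mem_elemAut_map_eq u v huv
  have hN := norm_add_norm_eq_autNorm γ u v huv
  have hm : MulAut.conj (p⁻¹ * γ (FreeGroup.mk [v])) * (γ * σ * shearAut) ∈ elemAut := by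
    apply hmin
    have : autNorm (MulAut.conj (p⁻¹ * γ (FreeGroup.mk [v])) * (γ * σ * shearAut)) =
        (p⁻¹ * (γ (FreeGroup.mk [v]) * γ (FreeGroup.mk [u])) * p).norm +
          (p⁻¹ * γ (FreeGroup.mk [v]) * p).norm := by
      simp only [autNorm, MulAut.mul_apply, shearAut_x, shearAut_y, map_mul, hx, hy,
        MulAut.conj_apply]
      congr 2 <;> group
    omega
  rwa [Subgroup.mul_mem_cancel_left _ (conj_mem_elemAut _),
    Subgroup.mul_mem_cancel_right _ shearAut_mem, Subgroup.mul_mem_cancel_right _ hσ] at hm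

lemma two_mul_gromov_lt {α : Type*} [DecidableEq α] {g : FreeGroup α} (hg : g ≠ 1) :
    2 * FreeGroup.gromov g⁻¹ g < g.norm := by
  have h1 := FreeGroup.norm_lt_norm_mul_self hg
  have h2 := FreeGroup.norm_mul_gromov g g
  omega

lemma mem_elemAut_or_gromov_le {γ : MulAut F2}
    (hmin : ∀ δ : MulAut F2, autNorm δ < autNorm γ → δ ∈ elemAut) {u v : Fin 2 × Bool}
    (huv : FreeGroup.mk [u] * FreeGroup.mk [v] ≠ 1) :
    γ ∈ elemAut ∨
    (2 * FreeGroup.gromov (γ (FreeGroup.mk [u]))⁻¹ (γ (FreeGroup.mk [v])) ≤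
        (γ (FreeGroup.mk [v])).norm ∧
      (2 * FreeGroup.gromov (γ (FreeGroup.mk [u]))⁻¹ (γ (FreeGroup.mk [v])) =
        (γ (FreeGroup.mk [v])).norm →
          u.1 ≠ v.1 ∧ (γ (FreeGroup.mk [v])).norm ≤ (γ (FreeGroup.mk [u])).norm)) := by
  by_cases hne : u.1 = v.1
  · rcases eq_or_eq_invLetter hne with rfl | rfl
    · have := two_mul_gromov_lt
        ((map_ne_one_iff γ γ.injective).2 (mk_singleton_ne_one v))
      right
      omega
    · rw [mk_invLetter, mul_inv_cancel] at huv
      exact absurd rfl huv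
  · rw [or_iff_not_imp_left]
    intro hγ
    have h1 := mt (mem_elemAut_of_norm_mul_lt hmin hne) hγ
    have h2 := mt (mem_elemAut_of_norm_mul_lt hmin (u := invLetter v) (v := invLetter u)
      (fun h => hne h.symm)) hγ
    rw [mk_invLetter, mk_invLetter, map_inv, map_inv, ← mul_inv_rev, FreeGroup.norm_inv_eq,
      FreeGroup.norm_inv_eq] at h2
    have h3 := FreeGroup.norm_mul_gromov (γ (FreeGroup.mk [u])) (γ (FreeGroup.mk [v]))
    exact ⟨by omega, fun h => ⟨hne, by omega⟩⟩

/-- **Nielsen**: the automorphism group of `F₂` is generated by the elementary automorphisms. -/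
theorem mem_elemAut (γ : MulAut F2) : γ ∈ elemAut := by
  induction hn : autNorm γ using Nat.strong_induction_on generalizing γ with
  | _ n ih =>
  subst hn
  have hmin : ∀ δ : MulAut F2, autNorm δ < autNorm γ → δ ∈ elemAut := fun δ hδ => ih _ hδ δ rfl
  by_contra hγ
  have h1 : ∀ u : Fin 2 × Bool, γ (FreeGroup.mk [u]) ≠ 1 := fun u =>
    (map_ne_one_iff γ γ.injective).2 (mk_singleton_ne_one u)
  have hnorm := FreeGroup.norm_le_norm_map γ.toMonoidHom h1 (by
    intro u v w huv hvw
    by_contra hlt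
    rw [not_lt] at hlt
    change (γ (FreeGroup.mk [v])).norm ≤ FreeGroup.gromov (γ (FreeGroup.mk [u]))⁻¹
      (γ (FreeGroup.mk [v])) + FreeGroup.gromov (γ (FreeGroup.mk [v]))⁻¹
      (γ (FreeGroup.mk [w])) at hlt
    obtain ⟨a1, a2⟩ := (mem_elemAut_or_gromov_le hmin huv).resolve_left hγ
    have hwv : FreeGroup.mk [invLetter w] * FreeGroup.mk [invLetter v] ≠ 1 := by
      rw [mk_invLetter, mk_invLetter, ← mul_inv_rev]
      exact inv_ne_one.2 hvw
    obtain ⟨b1, b2⟩ := (mem_elemAut_or_gromov_le hmin hwv).resolve_left hγ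
    simp only [mk_invLetter, map_inv, inv_inv, FreeGroup.norm_inv_eq] at b1 b2
    rw [FreeGroup.gromov_comm _ (γ (FreeGroup.mk [v]))⁻¹] at b1 b2
    obtain ⟨huv1, hle⟩ := a2 (by omega)
    obtain ⟨hwv1, -⟩ := b2 (by omega)
    have huw : u.1 = w.1 := by
      simp only [invLetter] at hwv1
      omega
    rcases eq_or_eq_invLetter huw with rfl | rfl
    · obtain ⟨p, hp⟩ := FreeGroup.exists_conj_norm_lt (h1 v)
        (u := γ (FreeGroup.mk [w])) (by omega) (by omega) hle
      exact hγ (mem_elemAut_of_norm_conj_lt hmin huv1 p hp)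
    · have h3 := two_mul_gromov_lt (h1 v)
      have h4 := FreeGroup.min_gromov_le (γ (FreeGroup.mk [v]))⁻¹ (γ (FreeGroup.mk [u]))⁻¹
        (γ (FreeGroup.mk [v]))
      rw [mk_invLetter, map_inv] at b1 hlt
      omega)
  have hletter : ∀ i : Fin 2, ∃ u : Fin 2 × Bool, γ (FreeGroup.mk [u]) = FreeGroup.of i := by
    intro i
    have h2 := hnorm (γ.symm (FreeGroup.of i))
    change _ ≤ (γ (γ.symm (FreeGroup.of i))).norm at h2
    rw [MulEquiv.apply_symm_apply, FreeGroup.norm_of] at h2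
    rcases hw : (γ.symm (FreeGroup.of i)).toWord with _ | ⟨u, _ | ⟨v, L⟩⟩
    · rw [FreeGroup.toWord_eq_nil_iff, map_eq_one_iff γ.symm γ.symm.injective] at hw
      exact absurd hw (FreeGroup.of_ne_one i)
    · exact ⟨u, by rw [← hw, FreeGroup.mk_toWord, MulEquiv.apply_symm_apply]⟩
    · simp [FreeGroup.norm, hw] at h2
  obtain ⟨u, hu⟩ := hletter 0
  obtain ⟨v, hv⟩ := hletter 1
  have huv : u.1 ≠ v.1 := by
    intro h
    rcases eq_or_eq_invLetter h with rfl | rfl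
    · exact absurd (FreeGroup.of_injective (hu.symm.trans hv)) (by decide)
    · rw [mk_invLetter, map_inv, hu] at hv
      exact absurd (congrArg FreeGroup.toWord hv) (by simp [FreeGroup.invRev])
  obtain ⟨σ, hσ, hx, hy⟩ := exists_mem_elemAut_map_eq u v huv
  have h2 : γ * σ = 1 := mulAut_F2_ext ((congrArg γ hx).trans hu) ((congrArg γ hy).trans hv)
  rw [mul_eq_one_iff_eq_inv] at h2
  exact hγ (h2 ▸ inv_mem hσ)

lemma toAdd_expSum_map (γ : MulAut F2) (i : Fin 2) (g : F2) :
    Multiplicative.toAdd (expSum i (γ g)) =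
      ∑ k, autMat γ i k * Multiplicative.toAdd (expSum k g) := by
  induction g using FreeGroup.induction_on with
  | C1 => simp
  | of j => simp [autMat, expSum]
  | inv_of j ih =>
    rw [map_inv, map_inv, toAdd_inv, ih]
    simp
  | mul g h hg hh =>
    rw [map_mul, map_mul, toAdd_mul, hg, hh]
    simp [mul_add, Finset.sum_add_distrib]

/-- The map `β̂` as a monoid homomorphism. -/
def autMatHom : MulAut F2 →* Matrix (Fin 2) (Fin 2) ℤ where
  toFun := autMat
  map_one' := by
    ext i j
    simp [autMat, expSum, Matrix.one_apply, eq_comm]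
  map_mul' γ δ := by
    ext i j
    rw [Matrix.mul_apply]
    exact toAdd_expSum_map γ i (δ (FreeGroup.of j))

lemma autMatHom_conj (w : F2) : autMatHom (MulAut.conj w) = 1 := by
  ext i j
  simp [autMatHom, autMat, expSum, Matrix.one_apply, eq_comm]

lemma autMatHom_eq {γ : MulAut F2} {a b c d : ℤ}
    (ha : Multiplicative.toAdd (expSum 0 (γ xg)) = a)
    (hb : Multiplicative.toAdd (expSum 0 (γ yg)) = b)
    (hc : Multiplicative.toAdd (expSum 1 (γ xg)) = c)
    (hd : Multiplicative.toAdd (expSum 1 (γ yg)) = d) :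
    autMatHom γ = !![a, b; c, d] := by
  subst ha hb hc hd
  ext i j
  fin_cases i <;> fin_cases j <;> rfl

lemma conj_range_normal : ((MulAut.conj : F2 →* MulAut F2).range).Normal := by
  constructor
  rintro _ ⟨w, rfl⟩ γ
  refine ⟨γ w, ?_⟩
  ext g
  simp [MulAut.conj_apply]

/-- **Nielsen**: an automorphism of `F₂` acting trivially on the abelianization is inner. -/
theorem exists_eq_conj_of_autMat_eq_one (γ : MulAut F2) (hγ : autMat γ = 1) :
    ∃ w : F2, γ = MulAut.conj w := by
  set N := (MulAut.conj : F2 →* MulAut F2).range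
  have : N.Normal := conj_range_normal
  let π : MulAut F2 →* MulAut F2 ⧸ N := QuotientGroup.mk' N
  let M : MulAut F2 ⧸ N →* Matrix (Fin 2) (Fin 2) ℤ :=
    (Units.coeHom _).comp (QuotientGroup.lift N autMatHom.toHomUnits (by
      rintro _ ⟨w, rfl⟩
      ext1
      exact autMatHom_conj w))
  have hM : ∀ δ, M (π δ) = autMatHom δ := fun δ => rfl
  have hπ : ∀ (w : F2) (δ : MulAut F2), π (MulAut.conj w * δ) = π δ := by
    intro w δ
    have : π (MulAut.conj w) = 1 := (QuotientGroup.eq_one_iff _).2 ⟨w, rfl⟩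
    rw [map_mul, this, one_mul]
  have hmem : π γ ∈ Subgroup.closure {π rotAut, π shearAut, π reflAut} := by
    have h1 : elemAut.map π ≤ Subgroup.closure {π rotAut, π shearAut, π reflAut} := by
      rw [elemAut, Subgroup.map_sup, MonoidHom.map_closure]
      refine sup_le ?_ (Subgroup.closure_mono ?_)
      · rintro _ ⟨_, ⟨w, rfl⟩, rfl⟩
        have := hπ w 1
        rw [mul_one, map_one] at this
        rw [this]
        exact one_mem _
      · simp [Set.image_insert_eq]
    exact h1 ⟨γ, mem_elemAut γ, rfl⟩
  have key : π γ = 1 := by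
    refine eq_one_of_mem_closure_triple_of_map_eq_one M ?_ ?_ ?_ ?_ ?_ ?_ ?_ ?_ ?_ hmem
      ((hM γ).trans hγ)
    · rw [hM]
      apply autMatHom_eq <;> simp <;> simp [expSum, xg, yg]
    · rw [hM]
      apply autMatHom_eq <;> simp <;> simp [expSum, xg, yg]
    · rw [hM]
      apply autMatHom_eq <;> simp <;> simp [expSum, xg, yg]
    · rw [← map_pow, ← map_one π]
      congr 1
      apply mulAut_F2_ext <;> simp [pow_succ]
    · rw [commute_iff_eq, ← map_pow, ← map_mul, ← map_mul, ← hπ yg⁻¹ (rotAut ^ 2 * shearAut)]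
      congr 1
      apply mulAut_F2_ext <;> simp [pow_succ, mul_assoc]
    · rw [← map_inv, ← map_mul, ← map_mul, ← map_mul, ← map_mul, ← hπ yg⁻¹ rotAut]
      congr 1
      apply mulAut_F2_ext <;> simp
    · rw [← map_mul, ← map_one π]
      congr 1
      apply mulAut_F2_ext <;> simp
    · rw [← map_mul, ← map_mul, ← map_inv]
      congr 1
      apply mulAut_F2_ext <;> simp
    · rw [← map_mul, ← map_mul, ← map_inv, ← hπ yg⁻¹ shearAut⁻¹]
      congr 1
      apply mulAut_F2_ext <;> simp [mul_assoc]
  obtain ⟨w, hw⟩ := (QuotientGroup.eq_one_iff _).1 key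
  exact ⟨w, hw.symm⟩

lemma map_eq_self_iff (γ : F2 ≃* F2) (V : Subgroup F2) :
    Subgroup.map γ.toMonoidHom V = V ↔ ∀ w, γ w ∈ V ↔ w ∈ V := by
  constructor
  · intro h w
    conv_lhs => rw [← h]
    exact Subgroup.mem_map_iff_mem γ.injective
  · intro h
    ext w
    constructor
    · rintro ⟨v, hv, rfl⟩
      exact (h v).2 hv
    · intro hw
      exact ⟨γ.symm w, (h _).1 (by simpa using hw), γ.apply_symm_apply w⟩

section Hgrp

variable {U : Subgroup F2} (α : U →* Multiplicative ℤ)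

lemma mem_Hgrp {n : ℕ} {w : F2} :
    w ∈ Hgrp α n ↔ ∃ hw : w ∈ U, (n : ℤ) ∣ Multiplicative.toAdd (α ⟨w, hw⟩) := by
  constructor
  · rintro ⟨u, hu, rfl⟩
    exact ⟨u.2, hu⟩
  · rintro ⟨hw, h⟩
    exact ⟨⟨w, hw⟩, h, rfl⟩

lemma Hgrp_le (n : ℕ) : Hgrp α n ≤ U := fun _ hw => ((mem_Hgrp α).1 hw).1

lemma conj_mem_Hgrp (n : ℕ) {u w : F2} (hu : u ∈ U) (hw : w ∈ Hgrp α n) :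
    u * w * u⁻¹ ∈ Hgrp α n := by
  obtain ⟨hwU, hw⟩ := (mem_Hgrp α).1 hw
  refine (mem_Hgrp α).2 ⟨mul_mem (mul_mem hu hwU) (inv_mem hu), ?_⟩
  have : α ⟨u * w * u⁻¹, mul_mem (mul_mem hu hwU) (inv_mem hu)⟩ = α ⟨w, hwU⟩ := by
    change α (⟨u, hu⟩ * ⟨w, hwU⟩ * ⟨u, hu⟩⁻¹) = _
    rw [map_mul, map_mul, map_inv, mul_inv_cancel_comm]
  rwa [this]

lemma conj_mem_Hgrp_iff (n : ℕ) {u w : F2} (hu : u ∈ U) :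
    u * w * u⁻¹ ∈ Hgrp α n ↔ w ∈ Hgrp α n := by
  refine ⟨fun h => ?_, conj_mem_Hgrp α n hu⟩
  simpa [mul_assoc] using conj_mem_Hgrp α n (inv_mem hu) h

lemma mem_Hgrp_zero_iff {S : Set ℕ} (hS : S.Infinite) {w : F2} :
    w ∈ Hgrp α 0 ↔ ∀ n ∈ S, w ∈ Hgrp α n := by
  simp only [mem_Hgrp]
  constructor
  · rintro ⟨hw, h⟩ n -
    refine ⟨hw, ?_⟩
    rw [Nat.cast_zero, zero_dvd_iff] at h
    rw [h]
    exact dvd_zero _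
  · intro h
    obtain ⟨n, hn⟩ := hS.nonempty
    obtain ⟨hw, -⟩ := h n hn
    refine ⟨hw, ?_⟩
    obtain ⟨m, hm, hlt⟩ := hS.exists_gt (Multiplicative.toAdd (α ⟨w, hw⟩)).natAbs
    obtain ⟨_, hdvd⟩ := h m hm
    rw [Nat.cast_zero, zero_dvd_iff]
    exact Int.eq_zero_of_dvd_of_natAbs_lt_natAbs hdvd (by simpa using hlt)

/-- An endomorphism preserving `U` and `H₀` preserves every `Hₙ`. -/
lemma map_mem_Hgrp (δ : F2 →* F2) (hδU : ∀ u ∈ U, δ u ∈ U)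
    (hδ : ∀ u ∈ Hgrp α 0, δ u ∈ Hgrp α 0) (t : U) (ht : α t = Multiplicative.ofAdd 1)
    (n : ℕ) {w : F2} (hw : w ∈ Hgrp α n) : δ w ∈ Hgrp α n := by
  obtain ⟨hwU, c, hc⟩ := (mem_Hgrp α).1 hw
  set a : ℤ := Multiplicative.toAdd (α ⟨w, hwU⟩) with ha
  have h0 : ((t ^ a)⁻¹ * ⟨w, hwU⟩ : U).1 ∈ Hgrp α 0 := by
    refine (mem_Hgrp α).2 ⟨Subtype.property _, ?_⟩
    simp only [Subtype.coe_eta]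
    rw [map_mul, map_inv, map_zpow, ht, toAdd_mul, toAdd_inv, toAdd_zpow, ← ha]
    simp
  obtain ⟨h1U, h1⟩ := (mem_Hgrp α).1 (hδ _ h0)
  rw [Nat.cast_zero, zero_dvd_iff, toAdd_eq_zero] at h1
  refine (mem_Hgrp α).2 ⟨hδU w hwU, ?_⟩
  have h2 : (⟨δ w, hδU w hwU⟩ : U) = ⟨δ t, hδU t t.2⟩ ^ a * ⟨_, h1U⟩ := by
    ext
    simp
  rw [h2, map_mul, h1, mul_one, map_zpow, toAdd_zpow, hc, smul_eq_mul, mul_assoc]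
  exact dvd_mul_right _ _

end Hgrp

/-- Setting A with Property B: `Stab(H₀) = ⋂_{n ≥ 1} Stab(Hₙ)` and
`Γ(H₀) = ⋂_{n ≥ 1} Γ(Hₙ)`. -/
theorem stab_H0_eq_iInter
    (k : ℕ) (hk : 2 ≤ k) (U : Subgroup F2) (hfin : U.FiniteIndex)
    (g : Fin k → F2)
    -- `g` is a free basis of `U`:
    (hgen : Subgroup.closure (Set.range g) = U)
    (hfree : Function.Injective ⇑(FreeGroup.lift g : FreeGroup (Fin k) →* F2))
    (hgU : ∀ j, g j ∈ U)
    -- `α : U → ℤ` is the homomorphism with `α(g₁) = 1` and `α(gⱼ) = 0` for `j ≥ 2`: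
    (α : U →* Multiplicative ℤ)
    (hα0 : α ⟨g ⟨0, by omega⟩, hgU _⟩ = Multiplicative.ofAdd 1)
    (hαj : ∀ j : Fin k, j ≠ ⟨0, by omega⟩ → α ⟨g j, hgU j⟩ = 1)
    -- Property B:
    (hB : ∀ w : F2, w ∉ U → ¬ ∀ h ∈ Hgrp α 0, w * h * w⁻¹ ∈ U)
    : StabSet (Hgrp α 0) = ⋂ (n : ℕ) (_ : 1 ≤ n), StabSet (Hgrp α n) ∧
      VeechGroup (Hgrp α 0) = ⋂ (n : ℕ) (_ : 1 ≤ n), VeechGroup (Hgrp α n) := by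
  have key : ∀ γ : F2 ≃* F2, γ ∈ StabSet (Hgrp α 0) → ∀ n : ℕ, γ ∈ StabSet (Hgrp α n) := by
    rintro γ ⟨hdet, hγ⟩ n
    rw [map_eq_self_iff] at hγ
    have hγU : ∀ w, γ w ∈ U ↔ w ∈ U := by
      intro w
      constructor
      · intro hw
        by_contra hwU
        refine hB w hwU fun h hh => Hgrp_le α 0 ?_
        rw [← hγ, map_mul, map_mul, map_inv]
        exact conj_mem_Hgrp α 0 hw ((hγ h).2 hh)
      · intro hw
        by_contra hwU
        refine hB _ hwU fun h hh => Hgrp_le α 0 ?_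
        have : γ w * h * (γ w)⁻¹ = γ (w * γ.symm h * w⁻¹) := by simp
        rw [this, hγ]
        exact conj_mem_Hgrp α 0 hw ((hγ _).1 (by simpa using hh))
    refine ⟨hdet, (map_eq_self_iff γ _).2 fun w => ⟨fun hw => ?_, fun hw => ?_⟩⟩
    · have := map_mem_Hgrp α γ.symm.toMonoidHom
        (fun u hu => (hγU _).1 (by simpa using hu))
        (fun u hu => (hγ _).1 (by simpa using hu)) _ hα0 n hw
      simpa using this
    · exact map_mem_Hgrp α γ.toMonoidHom (fun u hu => (hγU u).2 hu)
        (fun u hu => (hγ u).2 hu) _ hα0 n hw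
  have key' : ∀ (γ : F2 ≃* F2) (S : Set ℕ), S.Infinite →
      (∀ n ∈ S, γ ∈ StabSet (Hgrp α n)) → γ ∈ StabSet (Hgrp α 0) := by
    intro γ S hS h
    obtain ⟨n, hn⟩ := hS.nonempty
    refine ⟨(h n hn).1, (map_eq_self_iff γ _).2 fun w => ?_⟩
    rw [mem_Hgrp_zero_iff α hS, mem_Hgrp_zero_iff α hS]
    exact forall₂_congr fun m hm => (map_eq_self_iff γ _).1 (h m hm).2 w
  refine ⟨?_, ?_⟩
  · ext γ
    simp only [Set.mem_iInter]
    exact ⟨fun h n _ => key γ h n, fun h => key' γ _ (Set.Ici_infinite 1) fun n hn => h n hn⟩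
  · ext A
    simp only [Set.mem_iInter]
    refine ⟨fun ⟨γ, hγ, hA⟩ n _ => ⟨γ, key γ hγ n, hA⟩, fun h => ?_⟩
    choose γ hγ hA using fun n : ℕ => h (n + 1) (Nat.le_add_left 1 n)
    have hw : ∀ n, ∃ w, γ n = MulAut.conj w * γ 0 := by
      intro n
      obtain ⟨w, hw⟩ := exists_eq_conj_of_autMat_eq_one
        ((γ n : MulAut F2) * (γ 0 : MulAut F2)⁻¹) (by
          change autMatHom ((γ n : MulAut F2) * (γ 0 : MulAut F2)⁻¹) = 1
          have : autMatHom (γ n) = autMatHom (γ 0) := (hA n).symm.trans (hA 0)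
          rw [map_mul, this, ← map_mul, mul_inv_cancel, map_one])
      exact ⟨w, mul_inv_eq_iff_eq_mul.1 hw⟩
    choose w hw using hw
    obtain ⟨y, hy⟩ := Finite.exists_infinite_fiber (fun n => (QuotientGroup.mk (w n)⁻¹ : F2 ⧸ U))
    rw [Set.infinite_coe_iff] at hy
    obtain ⟨m, hm⟩ := hy.nonempty
    refine ⟨γ m, key' (γ m) _ (hy.image (Nat.succ_injective.injOn)) ?_, hA m⟩
    rintro _ ⟨n, hn, rfl⟩
    refine ⟨(hγ m).1, (map_eq_self_iff _ _).2 fun v => ?_⟩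
    have huU : w m * (w n)⁻¹ ∈ U := by
      simpa using QuotientGroup.eq.1 (hm.trans hn.symm)
    have h1 : γ m v = (w m * (w n)⁻¹) * γ n v * (w m * (w n)⁻¹)⁻¹ := by
      rw [hw m, hw n]
      simp [mul_assoc]
    rw [h1, conj_mem_Hgrp_iff α _ huU]
    exact (map_eq_self_iff _ _).1 (hγ n).2 v
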